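/- Let n ≥ 2. There is no D-relation D on ℚ^n that is invariant under AGL_n(ℚ), i.e., no quaternary relation D on ℚ^n satisfying axioms (d1)–(d5) such that D(σ(α),σ(β);σ(γ),σ(δ)) holds whenever D(α,β;γ,δ) holds and σ ∈ AGL_n(ℚ). -/

import Mathlib

/-- `σ` is an element of `AGL_n(ℚ)`: a permutation of `ℚ^n` of the form
`x ↦ T x + b` with `T` an invertible `ℚ`-linear map and `b ∈ ℚ^n`. -/
def IsAGL (n : ℕ) (σ : Equiv.Perm (Fin n → ℚ)) : Prop :=
  ∃ T : (Fin n → ℚ) ≃ₗ[ℚ] (Fin n → ℚ), ∃ b : Fin n → ℚ, ∀ x, σ x = T x + b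

/-- `D` is a D-relation on `X`. -/
def IsDRelation {X : Type*} (D : X → X → X → X → Prop) : Prop :=
  (∀ a b c d : X, D a b c d → D b a c d ∧ D c d a b) ∧
  (∀ a b c d : X, D a b c d → ¬ D a c b d) ∧
  (∀ a b c d e : X, D a b c d → D e b c d ∨ D a b c e) ∧
  (∀ a b c : X, a ≠ c → b ≠ c → D a b c c) ∧
  (∀ a b c : X, a ≠ b → a ≠ c → b ≠ c → ∃ d, c ≠ d ∧ D a b c d)

/-- Two vectors with a nonvanishing `2 × 2` minor have dual functionals. -/
lemma exists_dual_pair {n : ℕ} {u v : Fin n → ℚ} {i j : Fin n} (h : u i * v j ≠ u j * v i) :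
    ∃ f g : (Fin n → ℚ) →ₗ[ℚ] ℚ, f u = 1 ∧ f v = 0 ∧ g u = 0 ∧ g v = 1 := by
  have h' : u i * v j - u j * v i ≠ 0 := sub_ne_zero.2 h
  refine ⟨(u i * v j - u j * v i)⁻¹ • (v j • LinearMap.proj i - v i • LinearMap.proj j),
    (u i * v j - u j * v i)⁻¹ • (u i • LinearMap.proj j - u j • LinearMap.proj i), ?_, ?_, ?_, ?_⟩
  all_goals simp only [LinearMap.smul_apply, LinearMap.sub_apply, LinearMap.proj_apply, smul_eq_mul]
  · rw [inv_mul_eq_one₀ h']; ring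
  · ring
  · ring
  · rw [inv_mul_eq_one₀ h']

lemma exists_linearEquiv_fix_scale {n : ℕ} {u v : Fin n → ℚ} {i j : Fin n}
    (h : u i * v j ≠ u j * v i) {p : ℚ} (hp : p ≠ 0) :
    ∃ T : (Fin n → ℚ) ≃ₗ[ℚ] (Fin n → ℚ), T u = u ∧ T v = p • v := by
  obtain ⟨f, g, -, -, gu, gv⟩ := exists_dual_pair h
  let S (q : ℚ) : (Fin n → ℚ) →ₗ[ℚ] (Fin n → ℚ) := LinearMap.id + g.smulRight ((q - 1) • v)
  have hS (q : ℚ) (x : Fin n → ℚ) : S q x = x + g x • (q - 1) • v := by simp [S]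
  have inv (q r : ℚ) (hqr : q * r = 1) : S q ∘ₗ S r = LinearMap.id := by
    refine LinearMap.ext fun x => funext fun k => ?_
    simp [hS, gv]
    linear_combination (g x * v k) * hqr
  refine ⟨LinearEquiv.ofLinearMap (S p) (S p⁻¹) (inv _ _ (mul_inv_cancel₀ hp))
    (inv _ _ (inv_mul_cancel₀ hp)), ?_, ?_⟩
  · simp [hS, gu]
  · simp only [LinearEquiv.coe_ofLinearMap, hS, gv]
    module

lemma exists_linearEquiv_swap_scale {n : ℕ} {u v : Fin n → ℚ} {i j : Fin n}
    (h : u i * v j ≠ u j * v i) {p : ℚ} (hp : p ≠ 0) :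
    ∃ T : (Fin n → ℚ) ≃ₗ[ℚ] (Fin n → ℚ), T u = v ∧ T v = p • u := by
  obtain ⟨f, g, fu, fv, gu, gv⟩ := exists_dual_pair h
  let S (q r : ℚ) : (Fin n → ℚ) →ₗ[ℚ] (Fin n → ℚ) :=
    LinearMap.id + f.smulRight (q • v - u) + g.smulRight (r • u - v)
  have hS (q r : ℚ) (x : Fin n → ℚ) :
      S q r x = x + f x • (q • v - u) + g x • (r • u - v) := by simp [S]
  have inv (q r s t : ℚ) (hqt : q * t = 1) (hrs : r * s = 1) :
      S q r ∘ₗ S s t = LinearMap.id := by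
    refine LinearMap.ext fun x => funext fun k => ?_
    simp [hS, fu, fv, gu, gv]
    linear_combination (g x * v k) * hqt + (f x * u k) * hrs
  refine ⟨LinearEquiv.ofLinearMap (S 1 p) (S p⁻¹ 1) (inv _ _ _ _ (by simp) (mul_inv_cancel₀ hp))
    (inv _ _ _ _ (inv_mul_cancel₀ hp) (by simp)), ?_, ?_⟩
  · simp [hS, fu, gu]
  · simp [hS, fv, gv]

/-- An invariant D-relation does not separate `{u, v}` from `{0, p u}` when `u`, `v` are
linearly independent. -/
lemma not_invariant_d_three_collinear {n : ℕ}
    {D : (Fin n → ℚ) → (Fin n → ℚ) → (Fin n → ℚ) → (Fin n → ℚ) → Prop}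
    (hD : IsDRelation D)
    (inv : ∀ σ : Equiv.Perm (Fin n → ℚ), IsAGL n σ →
      ∀ a b c d, D a b c d → D (σ a) (σ b) (σ c) (σ d))
    {u v : Fin n → ℚ} {i j : Fin n} (h : u i * v j ≠ u j * v i) {p : ℚ} (hp : p ≠ 0) :
    ¬ D u v 0 (p • u) := by
  obtain ⟨d1, d2, d3, -, -⟩ := hD
  have flip {a b c d} (h : D a b c d) : D a b d c := (d1 _ _ _ _ (d1 _ _ _ _ (d1 _ _ _ _ h).2).1).2
  have lin (T : (Fin n → ℚ) ≃ₗ[ℚ] (Fin n → ℚ)) (H : D u v 0 (p • u)) :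
      D (T u) (T v) 0 (p • T u) := by
    simpa using inv T.toEquiv ⟨T, 0, by simp⟩ _ _ _ _ H
  intro H
  obtain ⟨S, Su, Sv⟩ := exists_linearEquiv_fix_scale h hp
  obtain ⟨T, Tu, Tv⟩ := exists_linearEquiv_swap_scale h hp
  have H₁ := lin S H
  have H₂ := lin T H
  rw [Su, Sv] at H₁
  rw [Tu, Tv] at H₂
  rcases d3 _ _ _ _ u H₂ with K | K
  · exact d2 _ _ _ _ (flip K) (flip H₁)
  · exact d2 _ _ _ _ (flip (d1 _ _ _ _ H).1) (flip K)

/-- For `n ≥ 2`, there is no `AGL_n(ℚ)`-invariant D-relation on `ℚ^n`. -/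
theorem no_agl_invariant_d_relation (n : ℕ) (hn : 2 ≤ n) :
    ¬ ∃ D : (Fin n → ℚ) → (Fin n → ℚ) → (Fin n → ℚ) → (Fin n → ℚ) → Prop,
      IsDRelation D ∧
      ∀ σ : Equiv.Perm (Fin n → ℚ), IsAGL n σ →
        ∀ a b c d, D a b c d → D (σ a) (σ b) (σ c) (σ d) := by
  rintro ⟨D, hD, inv⟩
  have key {u v : Fin n → ℚ} {i j : Fin n} (h : u i * v j ≠ u j * v i) {p : ℚ} (hp : p ≠ 0) :=
    not_invariant_d_three_collinear hD inv h hp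
  obtain ⟨d1, -, d3, -, d5⟩ := hD
  let i₀ : Fin n := ⟨0, by omega⟩
  let i₁ : Fin n := ⟨1, by omega⟩
  have hi : i₁ ≠ i₀ := by simp [i₀, i₁]
  let e : Fin n → ℚ := Pi.single i₀ 1
  have e0 : e i₀ = 1 := by simp [e]
  have ej {j : Fin n} (hj : j ≠ i₀) : e j = 0 := by simp [e, hj]
  have off {d : Fin n → ℚ} {j : Fin n} (hj : j ≠ i₀) (hd : d j ≠ 0) : ¬ D e ((2 : ℚ) • e) 0 d := by
    intro H
    have H' := (d1 _ _ _ _ (inv (Equiv.addRight (-e))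
      ⟨LinearEquiv.refl ℚ _, -e, fun x => rfl⟩ _ _ _ _ H)).2
    refine key (u := -e) (v := d - e) (i := i₀) (j := j) (p := -1) ?_ (by norm_num) ?_
    · simp [e0, ej hj, hd]
    · convert H' using 1
      · simp
      · simp [sub_eq_add_neg]
      · simp
      · simp only [Equiv.coe_addRight]
        module
  have hne : e ≠ 0 := fun h => by simpa [e0] using congrFun h i₀
  have hne₂ : (2 : ℚ) • e ≠ 0 := smul_ne_zero (by norm_num) hne
  have hne₁ : e ≠ (2 : ℚ) • e := fun h => by simpa [e0] using congrFun h i₀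
  obtain ⟨d, hd, H⟩ := d5 e ((2 : ℚ) • e) 0 hne₁ hne hne₂
  by_cases hline : ∀ j ≠ i₀, d j = 0
  · have hde : d = (d i₀ / 2) • (2 : ℚ) • e := by
      funext j
      by_cases hj : j = i₀
      · subst hj; simp [e0]
      · simp [hline j hj, ej hj]
    have ht : d i₀ / 2 ≠ 0 := fun h => hd (by rw [hde, h, zero_smul])
    rcases d3 _ _ _ _ (Pi.single i₁ 1) H with K | K
    · refine key (u := (2 : ℚ) • e) (v := Pi.single i₁ 1) (i := i₀) (j := i₁) ?_ ht ?_
      · simp [e0, ej hi]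
      · rw [← hde]
        exact (d1 _ _ _ _ K).1
    · exact off hi (by simp) K
  · push Not at hline
    obtain ⟨j, hj, hdj⟩ := hline
    exact off hj hdj H
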